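/- The convex hull of K equals the closure of U, i.e. convexHull(K) = closure(U). -/

import Mathlib

noncomputable section

open Matrix

abbrev En (n : ℕ) := EuclideanSpace ℝ (Fin n)

/-- The space of symmetric trace-free `n × n` real matrices, as a submodule. -/
def S0 (n : ℕ) : Submodule ℝ (Matrix (Fin n) (Fin n) ℝ) where
  carrier := {σ | σ.IsSymm ∧ σ.trace = 0}
  add_mem' := fun hA hB => ⟨hA.1.add hB.1, by simp [Matrix.trace_add, hA.2, hB.2]⟩
  zero_mem' := ⟨Matrix.isSymm_zero, by simp⟩
  smul_mem' := fun c A hA => ⟨by rw [Matrix.IsSymm, Matrix.transpose_smul, hA.1], by simp [hA.2]⟩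

/-- The state space `Z = ℝ × ℝⁿ × ℝⁿ × S₀ × ℝ`. -/
abbrev Zsp (n : ℕ) := ℝ × En n × En n × ↥(S0 n) × ℝ

/-- Outer product `w ⊗ m`. -/
def op {n : ℕ} (w m : En n) : Matrix (Fin n) (Fin n) ℝ := fun i j => w i * m j

/-- The largest eigenvalue of a (symmetric) matrix, as `sup {ξᵀ A ξ : |ξ| = 1}`. -/
def lamMax {n : ℕ} (A : Matrix (Fin n) (Fin n) ℝ) : ℝ :=
  sSup {r | ∃ ξ : En n, ‖ξ‖ = 1 ∧ r = ∑ i, ∑ j, ξ i * A i j * ξ j}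

/-- The matrix `M(z)`. -/
def Mmat {n : ℕ} (μm μp μ : ℝ) (w m : En n) (σ : Matrix (Fin n) (Fin n) ℝ) :
    Matrix (Fin n) (Fin n) ℝ :=
  (((μp - μ) * (μ - μm))⁻¹) •
      ((μ * μm * μp) • op w w - (μm * μp) • (op m w + op w m) + (μp + μm - μ) • op m m) - σ

/-- `T₊(z)`. -/
def Tp {n : ℕ} (μm μp μ : ℝ) (w m : En n) : ℝ :=
  (μp / (n : ℝ)) * ‖m - μm • w‖ ^ 2 / (μ - μm) ^ 2

/-- `T₋(z)`. -/
def Tm {n : ℕ} (μm μp μ : ℝ) (w m : En n) : ℝ :=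
  (μm / (n : ℝ)) * ‖m - μp • w‖ ^ 2 / (μ - μp) ^ 2

def TpZ {n : ℕ} (μm μp : ℝ) (z : Zsp n) : ℝ := Tp μm μp z.1 z.2.1 z.2.2.1

def TmZ {n : ℕ} (μm μp : ℝ) (z : Zsp n) : ℝ := Tm μm μp z.1 z.2.1 z.2.2.1

def QZ {n : ℕ} (μm μp : ℝ) (z : Zsp n) : ℝ :=
  lamMax (Mmat μm μp z.1 z.2.1 z.2.2.1 (z.2.2.2.1 : Matrix (Fin n) (Fin n) ℝ))

/-- The open relaxed set `U`. -/
def Uset (n : ℕ) (μm μp e : ℝ) : Set (Zsp n) :=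
  {z | z.1 ∈ Set.Ioo μm μp ∧ TpZ μm μp z < e ∧ TmZ μm μp z < e ∧ QZ μm μp z < e}

/-- The constraint set `K`. -/
def Kset (n : ℕ) (μm μp e : ℝ) : Set (Zsp n) :=
  {z | (z.1 = μm ∨ z.1 = μp) ∧ z.2.2.1 = z.1 • z.2.1 ∧
    z.1 • op z.2.1 z.2.1 - (z.2.2.2.1 : Matrix (Fin n) (Fin n) ℝ) =
      e • (1 : Matrix (Fin n) (Fin n) ℝ)}

/-- The wave cone `Λ`. -/
def Lambda (n : ℕ) : Set (Zsp n) :=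
  {z | ¬(z.1 = 0 ∧ z.2.2.1 = 0) ∧
    ∃ (ξ : Fin n → ℝ) (c : ℝ), ¬(ξ = 0 ∧ c = 0) ∧
      ((z.2.2.2.1 : Matrix (Fin n) (Fin n) ℝ) +
          z.2.2.2.2 • (1 : Matrix (Fin n) (Fin n) ℝ)).mulVec ξ + c • (fun i => z.2.2.1 i) = 0 ∧
      (∑ j, z.2.2.1 j * ξ j) + c * z.1 = 0 ∧
      (∑ j, z.2.1 j * ξ j) = 0}

/-- The projection `π(μ, w, m, σ, q) = (μ, w, m, σ)`. -/
def pz {n : ℕ} (z : Zsp n) : ℝ × En n × En n × ↥(S0 n) := (z.1, z.2.1, z.2.2.1, z.2.2.2.1)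

open Set Filter Topology

/-- The quadratic form `ξ ↦ ξᵀ A ξ`. -/
def quadForm {n : ℕ} (A : Matrix (Fin n) (Fin n) ℝ) (ξ : En n) : ℝ :=
  ∑ i, ∑ j, ξ i * A i j * ξ j

section QuadForm

variable {n : ℕ}

lemma quadForm_add (A B : Matrix (Fin n) (Fin n) ℝ) (ξ : En n) :
    quadForm (A + B) ξ = quadForm A ξ + quadForm B ξ := by
  simp [quadForm, mul_add, add_mul, Finset.sum_add_distrib]

lemma quadForm_sub (A B : Matrix (Fin n) (Fin n) ℝ) (ξ : En n) :
    quadForm (A - B) ξ = quadForm A ξ - quadForm B ξ := by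
  simp [quadForm, mul_sub, sub_mul, Finset.sum_sub_distrib]

lemma quadForm_smul (c : ℝ) (A : Matrix (Fin n) (Fin n) ℝ) (ξ : En n) :
    quadForm (c • A) ξ = c * quadForm A ξ := by
  simp only [quadForm, Matrix.smul_apply, smul_eq_mul, Finset.mul_sum]
  exact Finset.sum_congr rfl fun i _ => Finset.sum_congr rfl fun j _ => by ring

lemma quadForm_one (ξ : En n) : quadForm (1 : Matrix (Fin n) (Fin n) ℝ) ξ = ‖ξ‖ ^ 2 := by
  rw [EuclideanSpace.real_norm_sq_eq]
  simp [quadForm, Matrix.one_apply, sq]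

lemma quadForm_op (w m ξ : En n) : quadForm (op w m) ξ = inner ℝ w ξ * inner ℝ m ξ := by
  simp only [quadForm, op, PiLp.inner_apply, RCLike.inner_apply, conj_trivial,
    Finset.sum_mul_sum]
  exact Finset.sum_congr rfl fun i _ => Finset.sum_congr rfl fun j _ => by ring

lemma quadForm_smul_vec (A : Matrix (Fin n) (Fin n) ℝ) (c : ℝ) (ξ : En n) :
    quadForm A (c • ξ) = c ^ 2 * quadForm A ξ := by
  simp only [quadForm, PiLp.smul_apply, smul_eq_mul, Finset.mul_sum]
  exact Finset.sum_congr rfl fun i _ => Finset.sum_congr rfl fun j _ => by ring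

lemma quadForm_single (A : Matrix (Fin n) (Fin n) ℝ) (i : Fin n) :
    quadForm A (EuclideanSpace.single i 1) = A i i := by
  simp [quadForm, PiLp.single_apply]

lemma trace_le_of_quadForm_le {A : Matrix (Fin n) (Fin n) ℝ} {c : ℝ}
    (h : ∀ ξ, quadForm A ξ ≤ c * ‖ξ‖ ^ 2) : A.trace ≤ n * c := by
  calc A.trace ≤ ∑ _i : Fin n, c := Finset.sum_le_sum fun i _ => by
        simpa [quadForm_single] using h (EuclideanSpace.single i 1)
    _ = n * c := by simp

lemma trace_op (w m : En n) : (op w m).trace = inner ℝ w m := by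
  simp [Matrix.trace, op, PiLp.inner_apply, mul_comm]

lemma trace_op_self (w : En n) : (op w w).trace = ‖w‖ ^ 2 := by
  rw [trace_op, real_inner_self_eq_norm_sq]

lemma isSymm_op_self (w : En n) : (op w w).IsSymm :=
  Matrix.IsSymm.ext fun i j => mul_comm (w j) (w i)

lemma bddAbove_quadForm_unit (A : Matrix (Fin n) (Fin n) ℝ) :
    BddAbove {r | ∃ ξ : En n, ‖ξ‖ = 1 ∧ r = ∑ i, ∑ j, ξ i * A i j * ξ j} := by
  refine ⟨∑ i, ∑ j, |A i j|, ?_⟩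
  rintro r ⟨ξ, hξ, rfl⟩
  refine Finset.sum_le_sum fun i _ => Finset.sum_le_sum fun j _ => (le_abs_self _).trans ?_
  have hle : ∀ k, |ξ k| ≤ 1 := fun k => hξ ▸ PiLp.norm_apply_le ξ k
  rw [abs_mul, abs_mul]
  calc |ξ i| * |A i j| * |ξ j| ≤ 1 * |A i j| * 1 := by
        gcongr
        · exact hle i
        · exact hle j
    _ = |A i j| := by ring

lemma quadForm_le_of_lamMax_le {A : Matrix (Fin n) (Fin n) ℝ} {c : ℝ} (h : lamMax A ≤ c)
    (ξ : En n) : quadForm A ξ ≤ c * ‖ξ‖ ^ 2 := by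
  rcases eq_or_ne ξ 0 with rfl | hξ
  · simp [quadForm]
  have hn : ‖ξ‖ ≠ 0 := norm_ne_zero_iff.2 hξ
  have h1 : quadForm A (‖ξ‖⁻¹ • ξ) ≤ c :=
    (le_csSup (bddAbove_quadForm_unit A)
      ⟨‖ξ‖⁻¹ • ξ, by rw [norm_smul, norm_inv, norm_norm, inv_mul_cancel₀ hn], rfl⟩).trans h
  rw [quadForm_smul_vec, inv_pow, inv_mul_le_iff₀ (by positivity)] at h1
  linarith

lemma lamMax_le_of_quadForm_le (hn : 0 < n) {A : Matrix (Fin n) (Fin n) ℝ} {c : ℝ}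
    (h : ∀ ξ, quadForm A ξ ≤ c * ‖ξ‖ ^ 2) : lamMax A ≤ c := by
  refine csSup_le ⟨_, EuclideanSpace.single ⟨0, hn⟩ 1, by simp, rfl⟩ ?_
  rintro r ⟨ξ, hξ, rfl⟩
  have hξA := h ξ
  rwa [hξ, one_pow, mul_one] at hξA

lemma Matrix.PosSemidef.of_quadForm_nonneg {A : Matrix (Fin n) (Fin n) ℝ} (hA : A.IsSymm)
    (h : ∀ ξ, 0 ≤ quadForm A ξ) : A.PosSemidef := by
  refine .of_dotProduct_mulVec_nonneg (by simpa [Matrix.IsHermitian] using hA.eq) fun x => ?_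
  convert! h (WithLp.toLp 2 x) using 1
  simp [quadForm, dotProduct, Matrix.mulVec, Finset.mul_sum, mul_assoc]

lemma Matrix.PosSemidef.exists_sum_op {A : Matrix (Fin n) (Fin n) ℝ} (hA : A.PosSemidef) :
    ∃ (k : ℕ) (v : Fin k → En n), A = ∑ i, op (v i) (v i) := by
  obtain ⟨k, v, rfl⟩ := Matrix.posSemidef_iff_eq_sum_vecMulVec.1 hA
  exact ⟨k, fun i => WithLp.toLp 2 (v i), rfl⟩

lemma Matrix.PosSemidef.abs_apply_le_trace {A : Matrix (Fin n) (Fin n) ℝ} (hA : A.PosSemidef)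
    (i j : Fin n) : |A i j| ≤ A.trace := by
  have hdiag : ∀ l, A l l ≤ A.trace := fun l =>
    Finset.single_le_sum (f := fun l => A l l) (fun l _ => hA.diag_nonneg) (Finset.mem_univ l)
  have hAij : |A i j| ≤ (A i i + A j j) / 2 := by
    obtain ⟨k, v, rfl⟩ := hA.exists_sum_op
    simp only [Matrix.sum_apply, op, ← Finset.sum_add_distrib, Finset.sum_div]
    refine (Finset.abs_sum_le_sum_abs _ _).trans (Finset.sum_le_sum fun l _ => ?_)
    rw [abs_le]
    constructor <;> nlinarith [sq_nonneg (v l i + v l j), sq_nonneg (v l i - v l j)]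
  linarith [hdiag i, hdiag j]

end QuadForm

/-- The states of constant density `μ` with `m = μ w` and `μ w ⊗ w - σ ≤ e Id`. -/
def subsolutions (n : ℕ) (μ e : ℝ) : Set (Zsp n) :=
  {z | z.1 = μ ∧ z.2.2.1 = μ • z.2.1 ∧ ∀ ξ : En n,
    quadForm (μ • op z.2.1 z.2.1 - (z.2.2.2.1 : Matrix (Fin n) (Fin n) ℝ)) ξ ≤ e * ‖ξ‖ ^ 2}

section Subsolutions

variable {n : ℕ} {μm μp μ e : ℝ}

lemma mem_subsolutions {z : Zsp n} :
    z ∈ subsolutions n μ e ↔ z.1 = μ ∧ z.2.2.1 = μ • z.2.1 ∧ ∀ ξ : En n,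
      μ * inner ℝ z.2.1 ξ ^ 2 ≤
        e * ‖ξ‖ ^ 2 + quadForm (z.2.2.2.1 : Matrix (Fin n) (Fin n) ℝ) ξ := by
  simp [subsolutions, quadForm_sub, quadForm_smul, quadForm_op, sq]

lemma subsolutions_norm_sq_le {z : Zsp n} (hz : z ∈ subsolutions n μ e) :
    μ * ‖z.2.1‖ ^ 2 ≤ n * e := by
  simpa [Matrix.trace_sub, Matrix.trace_smul, trace_op_self, z.2.2.2.1.2.2] using
    trace_le_of_quadForm_le hz.2.2

lemma convex_subsolutions (hμ : 0 ≤ μ) : Convex ℝ (subsolutions n μ e) := by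
  intro x hx y hy a b ha hb hab
  rw [mem_subsolutions] at *
  refine ⟨?_, ?_, fun ξ => ?_⟩
  · simp [hx.1, hy.1, ← add_mul, hab]
  · simp only [Prod.snd_add, Prod.fst_add, Prod.smul_snd, Prod.smul_fst, hx.2.1, hy.2.1]
    module
  · have h1 := mul_le_mul_of_nonneg_left (hx.2.2 ξ) ha
    have h2 := mul_le_mul_of_nonneg_left (hy.2.2 ξ) hb
    have hsq := mul_nonneg (mul_nonneg hμ (mul_nonneg ha hb))
      (sq_nonneg (inner ℝ x.2.1 ξ - inner ℝ y.2.1 ξ))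
    obtain rfl : b = 1 - a := by linarith
    simp only [Prod.snd_add, Prod.fst_add, Prod.smul_snd, Prod.smul_fst, inner_add_left,
      real_inner_smul_left, Submodule.coe_add, Submodule.coe_smul, quadForm_add, quadForm_smul]
    linarith

lemma zero_mem_subsolutions (he : 0 ≤ e) : ((μ, 0, 0, 0, 0) : Zsp n) ∈ subsolutions n μ e := by
  rw [mem_subsolutions]
  refine ⟨rfl, by simp, fun ξ => ?_⟩
  simp only [inner_zero_left, ZeroMemClass.coe_zero]
  simp [quadForm]
  positivity

lemma smul_mem_subsolutions {z : Zsp n} (hz : z ∈ subsolutions n μ e) (hμ : 0 ≤ μ) {c : ℝ}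
    (hc : 0 ≤ c) (hc1 : c ≤ 1) : ((z.1, c • z.2) : Zsp n) ∈ subsolutions n μ (c * e) := by
  rw [mem_subsolutions] at *
  refine ⟨hz.1, ?_, fun ξ => ?_⟩
  · simp only [Prod.smul_fst, Prod.smul_snd, hz.2.1]
    exact smul_comm _ _ _
  · have h1 := mul_le_mul_of_nonneg_left (hz.2.2 ξ) hc
    have h2 := mul_nonneg (mul_nonneg hμ (sq_nonneg (inner ℝ z.2.1 ξ)))
      (mul_nonneg hc (sub_nonneg.2 hc1))
    simp only [Prod.smul_fst, Prod.smul_snd, real_inner_smul_left, Submodule.coe_smul,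
      quadForm_smul]
    linarith

lemma Kset_subset_subsolutions_union :
    Kset n μm μp e ⊆ subsolutions n μp e ∪ subsolutions n μm e := by
  rintro z ⟨hμ | hμ, hm, hσ⟩
  · refine Or.inr ⟨hμ, hμ ▸ hm, fun ξ => ?_⟩
    rw [← hμ, hσ, quadForm_smul, quadForm_one]
  · refine Or.inl ⟨hμ, hμ ▸ hm, fun ξ => ?_⟩
    rw [← hμ, hσ, quadForm_smul, quadForm_one]

lemma isSymm_smul_op_sub (z : Zsp n) :
    (e • (1 : Matrix (Fin n) (Fin n) ℝ) - (μ • op z.2.1 z.2.1 - z.2.2.2.1)).IsSymm :=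
  (Matrix.isSymm_one.smul e).sub (((isSymm_op_self _).smul μ).sub z.2.2.2.1.2.1)

lemma posSemidef_of_mem_subsolutions {z : Zsp n} (hz : z ∈ subsolutions n μ e) :
    (e • (1 : Matrix (Fin n) (Fin n) ℝ) - (μ • op z.2.1 z.2.1 - z.2.2.2.1)).PosSemidef :=
  .of_quadForm_nonneg (isSymm_smul_op_sub z) fun ξ => by
    rw [quadForm_sub, quadForm_smul, quadForm_one]
    exact sub_nonneg.2 (hz.2.2 ξ)

lemma mem_convexHull_Kset_of_sum_op (hμ : 0 < μ) (h : μ = μm ∨ μ = μp) {ι : Type*}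
    (s : Finset ι) (u : ι → En n) (w : En n) (σ : S0 n) (q : ℝ)
    (hσ : (σ : Matrix (Fin n) (Fin n) ℝ) =
      μ • op w w + ∑ k ∈ s, op (u k) (u k) - e • (1 : Matrix (Fin n) (Fin n) ℝ)) :
    ((μ, w, μ • w, σ, q) : Zsp n) ∈ convexHull ℝ (Kset n μm μp e) := by
  classical
  induction s using Finset.induction_on generalizing w σ with
  | empty =>
    refine subset_convexHull ℝ _ ⟨h, rfl, ?_⟩
    simp [hσ]
  | insert k s hk ih =>
    set c : ℝ := inner ℝ w (u k) / ‖u k‖ ^ 2 with hc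
    have hcu : c * ‖u k‖ ^ 2 = inner ℝ w (u k) := by
      rcases eq_or_ne (u k) 0 with h0 | h0
      · simp [h0]
      · have : ‖u k‖ ≠ 0 := norm_ne_zero_iff.2 h0
        rw [hc]
        field_simp
    set r := √(c ^ 2 + 1 / μ) with hr
    have hr2 : r ^ 2 = c ^ 2 + 1 / μ := Real.sq_sqrt (by positivity)
    have hcr : |c| < r := by
      rw [hr, ← Real.sqrt_sq_eq_abs]
      exact Real.sqrt_lt_sqrt (sq_nonneg c) (by linarith [one_div_pos.2 hμ])
    obtain ⟨hcr1, hcr2⟩ := abs_lt.1 hcr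
    have hr0 : 0 < r := (abs_nonneg c).trans_lt hcr
    have hab : μ * ((r - c) * (r + c)) = 1 := by
      have : (r - c) * (r + c) = 1 / μ := by linarith
      rw [this]
      field_simp
    rw [Finset.sum_insert hk] at hσ
    have htr : μ * ‖w‖ ^ 2 + (‖u k‖ ^ 2 + (∑ k ∈ s, op (u k) (u k)).trace) - e * n = 0 := by
      have := congrArg Matrix.trace hσ
      rw [σ.2.2] at this
      simpa [Matrix.trace_sub, Matrix.trace_add, Matrix.trace_smul, trace_op_self] using this.symm
    -- moving `w` along `u k` by either root of `x² + 2 c x = 1 / μ` preserves the trace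
    have key : ∀ x : ℝ, μ * (x ^ 2 + 2 * c * x) = 1 →
        ∃ τ : S0 n, (τ : Matrix (Fin n) (Fin n) ℝ) = μ • op (w + x • u k) (w + x • u k) +
          ∑ k ∈ s, op (u k) (u k) - e • (1 : Matrix (Fin n) (Fin n) ℝ) := by
      intro x hx
      refine ⟨⟨_, ?_, ?_⟩, rfl⟩
      · refine (((isSymm_op_self _).smul μ).add ?_).sub (Matrix.isSymm_one.smul e)
        rw [Matrix.IsSymm, Matrix.transpose_sum]
        exact Finset.sum_congr rfl fun i _ => isSymm_op_self _
      · simp only [Matrix.trace_sub, Matrix.trace_add, Matrix.trace_smul, trace_op_self,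
          Matrix.trace_one, Fintype.card_fin, smul_eq_mul]
        rw [norm_add_sq_real, norm_smul, mul_pow, real_inner_smul_right, ← hcu,
          Real.norm_eq_abs, sq_abs]
        linear_combination htr + ‖u k‖ ^ 2 * hx
    obtain ⟨τ₁, hτ₁⟩ := key (r - c) (by linear_combination hab)
    obtain ⟨τ₂, hτ₂⟩ := key (-(r + c)) (by linear_combination hab)
    have h1 := ih _ τ₁ hτ₁
    have h2 := ih _ τ₂ hτ₂
    have hsum : (r + c) / (2 * r) + (r - c) / (2 * r) = 1 := by
      field_simp
      ring
    have hbal : (r + c) / (2 * r) * (r - c) + (r - c) / (2 * r) * (-(r + c)) = 0 := by ring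
    have hquad : μ * ((r + c) / (2 * r) * (r - c) ^ 2 + (r - c) / (2 * r) * (r + c) ^ 2) = 1 := by
      rw [← hab]
      field_simp
      ring
    have hmem := convex_convexHull ℝ (Kset n μm μp e) h1 h2
      (div_nonneg (by linarith) (by linarith) : 0 ≤ (r + c) / (2 * r))
      (div_nonneg (by linarith) (by linarith) : 0 ≤ (r - c) / (2 * r)) hsum
    generalize (r + c) / (2 * r) = α at *
    generalize (r - c) / (2 * r) = β at *
    convert! hmem using 1
    have hw : w = α • (w + (r - c) • u k) + β • (w + (-(r + c)) • u k) := by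
      linear_combination (norm := module) -hsum • w - hbal • u k
    refine Prod.ext ?_ (Prod.ext hw (Prod.ext ?_ (Prod.ext ?_ ?_)))
    · simp [← add_mul, hsum]
    · conv_lhs => rw [hw]
      simp only [Prod.snd_add, Prod.fst_add, Prod.smul_snd, Prod.smul_fst]
      module
    · ext i j
      simp only [Prod.snd_add, Prod.fst_add, Prod.smul_snd, Prod.smul_fst, Submodule.coe_add,
        Submodule.coe_smul, hσ, hτ₁, hτ₂, Matrix.add_apply, Matrix.sub_apply, Matrix.smul_apply,
        smul_eq_mul, op, PiLp.add_apply, PiLp.smul_apply]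
      generalize (∑ k ∈ s, op (u k) (u k)) i j = S
      generalize (1 : Matrix (Fin n) (Fin n) ℝ) i j = I
      linear_combination (e * I - S - μ * w i * w j) * hsum -
        (μ * w i * u k j + μ * w j * u k i) * hbal - u k i * u k j * hquad
    · simp [← add_mul, hsum]

lemma subsolutions_subset_convexHull_Kset (hμ : 0 < μ) (h : μ = μm ∨ μ = μp) :
    subsolutions n μ e ⊆ convexHull ℝ (Kset n μm μp e) := by
  intro z hz
  obtain ⟨k, v, hv⟩ := (posSemidef_of_mem_subsolutions hz).exists_sum_op
  obtain ⟨μ', w, m, σ, q⟩ := z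
  obtain ⟨rfl, (rfl : m = μ' • w), -⟩ := hz
  refine mem_convexHull_Kset_of_sum_op hμ h Finset.univ v w σ q ?_
  rw [← hv]
  abel

end Subsolutions

section Closedness

variable {n : ℕ} {μm μp μ e : ℝ}

lemma isClosed_subsolutions : IsClosed (subsolutions n μ e) := by
  have hS : ∀ i j, Continuous fun z : Zsp n => (z.2.2.2.1 : Matrix (Fin n) (Fin n) ℝ) i j :=
    fun i j => (continuous_subtype_val.comp (by fun_prop)).matrix_elem i j
  have hset : subsolutions n μ e = {z : Zsp n | z.1 = μ} ∩ ({z | z.2.2.1 = μ • z.2.1} ∩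
      ⋂ ξ : En n, {z | μ * inner ℝ z.2.1 ξ ^ 2 ≤
        e * ‖ξ‖ ^ 2 + quadForm (z.2.2.2.1 : Matrix (Fin n) (Fin n) ℝ) ξ}) := by
    ext z
    simp [mem_subsolutions]
  have hw : Continuous fun z : Zsp n => z.2.1 := by fun_prop
  have hm : Continuous fun z : Zsp n => z.2.2.1 := by fun_prop
  rw [hset]
  refine (isClosed_eq continuous_fst continuous_const).inter
    ((isClosed_eq hm (hw.const_smul μ)).inter (isClosed_iInter fun ξ => isClosed_le ?_ ?_))
  · exact ((hw.inner continuous_const).pow 2).const_mul μ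
  · exact continuous_const.add (continuous_finsetSum _ fun i _ => continuous_finsetSum _
      fun j _ => (continuous_const.mul (hS i j)).mul continuous_const)

lemma abs_apply_le_of_mem_subsolutions {z : Zsp n} (hz : z ∈ subsolutions n μ e) (hμ : 0 < μ)
    (he : 0 ≤ e) (i j : Fin n) :
    |(z.2.2.2.1 : Matrix (Fin n) (Fin n) ℝ) i j| ≤ n * e + e := by
  have h1 := (posSemidef_of_mem_subsolutions hz).abs_apply_le_trace i j
  simp only [Matrix.trace_sub, Matrix.trace_smul, trace_op_self, z.2.2.2.1.2.2,
    Matrix.trace_one, Fintype.card_fin, smul_eq_mul, Matrix.sub_apply, Matrix.smul_apply, op]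
    at h1
  have h2 : |e * (1 : Matrix (Fin n) (Fin n) ℝ) i j| ≤ e := by
    rw [abs_mul, abs_of_nonneg he, Matrix.one_apply]
    split_ifs <;> simp [he]
  have h3 : |μ * (z.2.1 i * z.2.1 j)| ≤ μ * ‖z.2.1‖ ^ 2 := by
    rw [abs_mul, abs_of_pos hμ, abs_mul, sq]
    gcongr
    · exact PiLp.norm_apply_le z.2.1 i
    · exact PiLp.norm_apply_le z.2.1 j
  rw [abs_le] at *
  constructor <;> linarith

lemma isCompact_subsolutions_inter (hμ : 0 < μ) (he : 0 ≤ e) :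
    IsCompact (subsolutions n μ e ∩ {z | z.2.2.2.2 = 0}) := by
  set R := √(n * e / μ)
  have hS : IsCompact {σ : S0 n | ∀ i j, (σ : Matrix (Fin n) (Fin n) ℝ) i j ∈
      Icc (-(n * e + e)) (n * e + e)} := by
    have hpi : IsCompact {A : Matrix (Fin n) (Fin n) ℝ |
        ∀ i, A i ∈ {v : Fin n → ℝ | ∀ j, v j ∈ Icc (-(n * e + e)) (n * e + e)}} :=
      isCompact_pi_infinite fun _ => isCompact_pi_infinite fun _ => isCompact_Icc
    exact ((S0 n).closed_of_finiteDimensional.isClosedEmbedding_subtypeVal).isCompact_preimage hpi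
  refine IsCompact.of_isClosed_subset
    ((isCompact_singleton (x := μ)).prod ((isCompact_closedBall (0 : En n) R).prod
      ((isCompact_closedBall (0 : En n) (μ * R)).prod (hS.prod (isCompact_singleton (x := 0))))))
    (isClosed_subsolutions.inter (isClosed_eq (by fun_prop) (by fun_prop))) ?_
  rintro z ⟨hz, hq⟩
  have hw : ‖z.2.1‖ ≤ R := by
    refine Real.le_sqrt_of_sq_le ?_
    rw [le_div_iff₀ hμ]
    linarith [subsolutions_norm_sq_le hz]
  refine ⟨hz.1, by simpa using hw, ?_, fun i j => ?_, hq⟩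
  · rw [mem_closedBall_zero_iff, hz.2.1, norm_smul, Real.norm_eq_abs, abs_of_pos hμ]
    gcongr
  · exact abs_le.1 (abs_apply_le_of_mem_subsolutions hz hμ he i j)

lemma mem_subsolutions_of_pz_eq {z z' : Zsp n} (hz : z ∈ subsolutions n μ e)
    (h : pz z = pz z') : z' ∈ subsolutions n μ e := by
  simp only [pz, Prod.mk.injEq] at h
  obtain ⟨h1, h2, h3, h4⟩ := h
  rw [mem_subsolutions] at *
  rwa [← h1, ← h2, ← h3, ← h4]

lemma IsCompact.convexJoin {E : Type*} [AddCommGroup E] [Module ℝ E] [TopologicalSpace E]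
    [ContinuousAdd E] [ContinuousSMul ℝ E] {s t : Set E} (hs : IsCompact s) (ht : IsCompact t) :
    IsCompact (convexJoin ℝ s t) := by
  convert! ((hs.prod ht).prod (isCompact_Icc (a := (0 : ℝ)) (b := 1))).image
    (f := fun p => (1 - p.2) • p.1.1 + p.2 • p.1.2) (by fun_prop) using 1
  ext x
  simp only [mem_convexJoin, segment_eq_image, mem_image, Prod.exists, mem_prod]
  constructor
  · rintro ⟨a, ha, b, hb, θ, hθ, rfl⟩
    exact ⟨a, b, θ, ⟨⟨ha, hb⟩, hθ⟩, rfl⟩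
  · rintro ⟨a, b, θ, ⟨⟨ha, hb⟩, hθ⟩, rfl⟩
    exact ⟨a, ha, b, hb, θ, hθ, rfl⟩

lemma isClosed_convexJoin_subsolutions (hμm : 0 < μm) (hμp : 0 < μp) (he : 0 ≤ e) :
    IsClosed (convexJoin ℝ (subsolutions n μp e) (subsolutions n μm e)) := by
  have hclosed := ((isCompact_subsolutions_inter (n := n) hμp he).convexJoin
    (isCompact_subsolutions_inter hμm he)).isClosed.preimage
    (f := fun z : Zsp n => ((z.1, z.2.1, z.2.2.1, z.2.2.2.1, 0) : Zsp n)) (by fun_prop)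
  convert! hclosed using 1
  ext z
  simp only [mem_preimage, mem_convexJoin]
  constructor
  · rintro ⟨x, hx, y, hy, a, b, ha, hb, hab, rfl⟩
    exact ⟨(x.1, x.2.1, x.2.2.1, x.2.2.2.1, 0), ⟨mem_subsolutions_of_pz_eq hx rfl, rfl⟩,
      (y.1, y.2.1, y.2.2.1, y.2.2.2.1, 0), ⟨mem_subsolutions_of_pz_eq hy rfl, rfl⟩,
      a, b, ha, hb, hab, by simp⟩
  · rintro ⟨x, hx, y, hy, a, b, ha, hb, hab, h⟩
    simp only [Prod.ext_iff] at h
    refine ⟨(x.1, x.2.1, x.2.2.1, x.2.2.2.1, z.2.2.2.2), mem_subsolutions_of_pz_eq hx.1 rfl,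
      (y.1, y.2.1, y.2.2.1, y.2.2.2.1, z.2.2.2.2), mem_subsolutions_of_pz_eq hy.1 rfl,
      a, b, ha, hb, hab, ?_⟩
    refine Prod.ext h.1 (Prod.ext h.2.1 (Prod.ext h.2.2.1 (Prod.ext h.2.2.2.1 ?_)))
    simp [← add_mul, hab]

end Closedness

section ConvexHull

variable {n : ℕ} {μm μp e : ℝ}

lemma convexHull_Kset_eq_convexJoin (hμm : 0 < μm) (hμp : 0 < μp) (he : 0 ≤ e) :
    convexHull ℝ (Kset n μm μp e) =
      convexJoin ℝ (subsolutions n μp e) (subsolutions n μm e) := by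
  refine (convexHull_min ?_ ((convex_subsolutions hμp.le).convexJoin
    (convex_subsolutions hμm.le))).antisymm
    (convexJoin_subset (subsolutions_subset_convexHull_Kset hμp (Or.inr rfl))
      (subsolutions_subset_convexHull_Kset hμm (Or.inl rfl)) (convex_convexHull ℝ _))
  exact Kset_subset_subsolutions_union.trans (union_subset
    (subset_convexJoin_left ⟨_, zero_mem_subsolutions he⟩)
    (subset_convexJoin_right ⟨_, zero_mem_subsolutions he⟩))

lemma Mmat_convexCombination (hμ : μm < μp) {t : ℝ} (ht0 : 0 < t) (ht1 : t < 1) (w₁ w₂ : En n)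
    (σ : Matrix (Fin n) (Fin n) ℝ) :
    Mmat μm μp (t * μp + (1 - t) * μm) (t • w₁ + (1 - t) • w₂)
        (t • μp • w₁ + (1 - t) • μm • w₂) σ =
      t • μp • op w₁ w₁ + (1 - t) • μm • op w₂ w₂ - σ := by
  have h1 : μp - (t * μp + (1 - t) * μm) = (1 - t) * (μp - μm) := by ring
  have h2 : t * μp + (1 - t) * μm - μm = t * (μp - μm) := by ring
  have h3 : μp - μm ≠ 0 := (sub_pos.2 hμ).ne'
  have h4 : 1 - t ≠ 0 := (sub_pos.2 ht1).ne'
  ext i j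
  simp only [Mmat, h1, h2, op, Matrix.add_apply, Matrix.sub_apply, Matrix.smul_apply,
    smul_eq_mul, PiLp.add_apply, PiLp.smul_apply]
  field_simp
  ring

lemma Tp_convexCombination (hμ : μm < μp) {t : ℝ} (ht0 : 0 < t) (w₁ w₂ : En n) :
    Tp μm μp (t * μp + (1 - t) * μm) (t • w₁ + (1 - t) • w₂)
      (t • μp • w₁ + (1 - t) • μm • w₂) = μp * ‖w₁‖ ^ 2 / n := by
  have h1 : t • μp • w₁ + (1 - t) • μm • w₂ - μm • (t • w₁ + (1 - t) • w₂) =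
      (t * (μp - μm)) • w₁ := by module
  have h2 : t * μp + (1 - t) * μm - μm = t * (μp - μm) := by ring
  have h3 : μp - μm ≠ 0 := (sub_pos.2 hμ).ne'
  rw [Tp, h1, h2, norm_smul, mul_pow, Real.norm_eq_abs, sq_abs]
  field_simp

lemma Tm_convexCombination (hμ : μm < μp) {t : ℝ} (ht1 : t < 1) (w₁ w₂ : En n) :
    Tm μm μp (t * μp + (1 - t) * μm) (t • w₁ + (1 - t) • w₂)
      (t • μp • w₁ + (1 - t) • μm • w₂) = μm * ‖w₂‖ ^ 2 / n := by
  have h1 : t • μp • w₁ + (1 - t) • μm • w₂ - μp • (t • w₁ + (1 - t) • w₂) =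
      ((1 - t) * (μm - μp)) • w₂ := by module
  have h2 : t * μp + (1 - t) * μm - μp = (1 - t) * (μm - μp) := by ring
  have h3 : 1 - t ≠ 0 := (sub_pos.2 ht1).ne'
  have h4 : μm - μp ≠ 0 := (sub_neg.2 hμ).ne
  rw [Tm, h1, h2, norm_smul, mul_pow, Real.norm_eq_abs, sq_abs]
  field_simp

lemma convexCombination_mem_Uset (hn : 0 < n) (hμ : μm < μp) {t : ℝ} (ht0 : 0 < t) (ht1 : t < 1)
    {e' : ℝ} (he : e' < e) {x y : Zsp n} (hx : x ∈ subsolutions n μp e')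
    (hy : y ∈ subsolutions n μm e') : t • x + (1 - t) • y ∈ Uset n μm μp e := by
  have hn' : (0 : ℝ) < n := Nat.cast_pos.2 hn
  have hx' := subsolutions_norm_sq_le hx
  have hy' := subsolutions_norm_sq_le hy
  obtain ⟨μ₁, w₁, m₁, σ₁, q₁⟩ := x
  obtain ⟨μ₂, w₂, m₂, σ₂, q₂⟩ := y
  obtain ⟨rfl, (rfl : m₁ = μ₁ • w₁), hx⟩ := hx
  obtain ⟨rfl, (rfl : m₂ = μ₂ • w₂), hy⟩ := hy
  dsimp only at *
  refine ⟨⟨?_, ?_⟩, ?_, ?_, ?_⟩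
  · change μ₂ < t * μ₁ + (1 - t) * μ₂
    nlinarith [mul_pos ht0 (sub_pos.2 hμ)]
  · change t * μ₁ + (1 - t) * μ₂ < μ₁
    nlinarith [mul_pos (sub_pos.2 ht1) (sub_pos.2 hμ)]
  · refine (Tp_convexCombination hμ ht0 w₁ w₂).trans_lt ?_
    rw [div_lt_iff₀ hn']
    nlinarith
  · refine (Tm_convexCombination hμ ht1 w₁ w₂).trans_lt ?_
    rw [div_lt_iff₀ hn']
    nlinarith
  · refine lt_of_le_of_lt (lamMax_le_of_quadForm_le hn fun ξ => ?_) he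
    refine (congrArg (quadForm · ξ) (Mmat_convexCombination hμ ht0 ht1 w₁ w₂ _)).trans_le ?_
    have h1 := mul_le_mul_of_nonneg_left (hx ξ) ht0.le
    have h2 := mul_le_mul_of_nonneg_left (hy ξ) (sub_pos.2 ht1).le
    simp only [Prod.snd_add, Prod.fst_add, Prod.smul_snd, Prod.smul_fst, Submodule.coe_add,
      Submodule.coe_smul, quadForm_add, quadForm_sub, quadForm_smul] at h1 h2 ⊢
    linarith

lemma convexJoin_subsolutions_subset_closure_Uset (hn : 0 < n) (hμm : 0 < μm) (hμ : μm < μp)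
    (he : 0 < e) :
    convexJoin ℝ (subsolutions n μp e) (subsolutions n μm e) ⊆ closure (Uset n μm μp e) := by
  intro z hz
  obtain ⟨x, hx, y, hy, a, b, ha, hb, hab, rfl⟩ := mem_convexJoin.1 hz
  obtain rfl : b = 1 - a := by linarith
  set f : ℝ → Zsp n := fun c => (c * a + (1 - c) / 2) • ((x.1, c • x.2) : Zsp n) +
    (1 - (c * a + (1 - c) / 2)) • ((y.1, c • y.2) : Zsp n)
  have hf : Continuous f := by fun_prop
  have hf1 : f 1 = a • x + (1 - a) • y := Prod.ext (by simp [f]) (by simp [f])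
  rw [← hf1]
  refine mem_closure_of_tendsto (f := f) (b := 𝓝[<] 1) (hf.tendsto 1 |>.mono_left inf_le_left) ?_
  filter_upwards [Ioo_mem_nhdsLT (zero_lt_one (α := ℝ))] with c hc
  have hca := mul_nonneg hc.1.le ha
  have hcb := mul_nonneg hc.1.le hb
  exact convexCombination_mem_Uset hn hμ (by linarith [hc.2]) (by linarith [hc.2])
    (mul_lt_of_lt_one_left he hc.2)
    (smul_mem_subsolutions hx (hμm.trans hμ).le hc.1.le hc.2.le)
    (smul_mem_subsolutions hy hμm.le hc.1.le hc.2.le)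

lemma exists_convexCombination (hμ : μm < μp) {μ : ℝ} (hμ' : μ ∈ Ioo μm μp) (w m : En n) :
    ∃ (t : ℝ) (w₁ w₂ : En n), 0 < t ∧ t < 1 ∧ μ = t * μp + (1 - t) * μm ∧
      w = t • w₁ + (1 - t) • w₂ ∧ m = t • μp • w₁ + (1 - t) • μm • w₂ := by
  have h0 : 0 < μp - μm := sub_pos.2 hμ
  have h1 : 0 < μ - μm := sub_pos.2 hμ'.1
  have h2 : 0 < μp - μ := sub_pos.2 hμ'.2
  have h3 : 1 - (μ - μm) / (μp - μm) = (μp - μ) / (μp - μm) := by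
    field_simp
    ring
  refine ⟨(μ - μm) / (μp - μm), (μ - μm)⁻¹ • (m - μm • w), (μp - μ)⁻¹ • (μp • w - m),
    by positivity, ?_, ?_, ?_, ?_⟩
  · rw [← sub_pos, h3]
    positivity
  · rw [h3]
    field_simp
    ring
  · rw [h3]
    match_scalars <;> field_simp <;> ring
  · rw [h3]
    match_scalars <;> field_simp <;> ring

lemma mk_mem_subsolutions (μ : ℝ) (w : En n) (q : ℝ) {P : Matrix (Fin n) (Fin n) ℝ}
    (hP : P.IsSymm) (hP0 : ∀ ξ, 0 ≤ quadForm P ξ) (htr : P.trace = n * e - μ * ‖w‖ ^ 2) :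
    ∃ σ : S0 n, (σ : Matrix (Fin n) (Fin n) ℝ) = P + μ • op w w - e • 1 ∧
      ((μ, w, μ • w, σ, q) : Zsp n) ∈ subsolutions n μ e := by
  refine ⟨⟨P + μ • op w w - e • 1, ?_, ?_⟩, rfl, rfl, rfl, fun ξ => ?_⟩
  · exact (hP.add ((isSymm_op_self w).smul μ)).sub (Matrix.isSymm_one.smul e)
  · simp only [Matrix.trace_sub, Matrix.trace_add, Matrix.trace_smul, trace_op_self, htr,
      Matrix.trace_one, Fintype.card_fin, smul_eq_mul]
    ring
  · have := hP0 ξ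
    simp only [quadForm_sub, quadForm_add, quadForm_smul, quadForm_one]
    linarith

lemma Uset_subset_convexJoin_subsolutions (hn : 0 < n) (hμ : μm < μp) :
    Uset n μm μp e ⊆ convexJoin ℝ (subsolutions n μp e) (subsolutions n μm e) := by
  rintro ⟨μ, w, m, σ, q⟩ ⟨hμ', hTp, hTm, hQ⟩
  obtain ⟨t, w₁, w₂, ht0, ht1, rfl, rfl, rfl⟩ := exists_convexCombination hμ hμ' w m
  have hn' : (0 : ℝ) < n := Nat.cast_pos.2 hn
  have ht1' : 0 < 1 - t := sub_pos.2 ht1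
  replace hTp : μp * ‖w₁‖ ^ 2 / n < e := (Tp_convexCombination hμ ht0 w₁ w₂).symm.trans_lt hTp
  replace hTm : μm * ‖w₂‖ ^ 2 / n < e := (Tm_convexCombination hμ ht1 w₁ w₂).symm.trans_lt hTm
  replace hQ : lamMax (t • μp • op w₁ w₁ + (1 - t) • μm • op w₂ w₂ -
      (σ : Matrix (Fin n) (Fin n) ℝ)) < e :=
    (congrArg lamMax (Mmat_convexCombination hμ ht0 ht1 w₁ w₂ σ)).symm.trans_lt hQ
  rw [div_lt_iff₀ hn', mul_comm e, ← sub_pos] at hTp hTm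
  set P : Matrix (Fin n) (Fin n) ℝ :=
    e • 1 - (t • μp • op w₁ w₁ + (1 - t) • μm • op w₂ w₂ - σ) with hP
  have hPsymm : P.IsSymm := (Matrix.isSymm_one.smul e).sub
    (((((isSymm_op_self w₁).smul μp).smul t).add
      (((isSymm_op_self w₂).smul μm).smul (1 - t))).sub σ.2.1)
  have hP0 : ∀ ξ, 0 ≤ quadForm P ξ := fun ξ => by
    rw [hP, quadForm_sub, quadForm_smul, quadForm_one]
    exact sub_nonneg.2 (quadForm_le_of_lamMax_le hQ.le ξ)
  have hPtr : P.trace =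
      t * (n * e - μp * ‖w₁‖ ^ 2) + (1 - t) * (n * e - μm * ‖w₂‖ ^ 2) := by
    simp only [hP, Matrix.trace_sub, Matrix.trace_add, Matrix.trace_smul, trace_op_self,
      Matrix.trace_one, Fintype.card_fin, smul_eq_mul, σ.2.2]
    ring
  have hPpos : 0 < P.trace := by
    rw [hPtr]
    positivity
  -- distribute `P` between the two phases in proportion to the prescribed traces
  have hscale : ∀ d : ℝ, 0 < d → ((d / P.trace) • P).IsSymm ∧
      (∀ ξ, 0 ≤ quadForm ((d / P.trace) • P) ξ) ∧ ((d / P.trace) • P).trace = d := by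
    refine fun d hd => ⟨hPsymm.smul _, fun ξ => ?_, ?_⟩
    · rw [quadForm_smul]
      exact mul_nonneg (by positivity) (hP0 ξ)
    · rw [Matrix.trace_smul, smul_eq_mul, div_mul_cancel₀ _ hPpos.ne']
  obtain ⟨hs₁, hp₁, htr₁⟩ := hscale _ hTp
  obtain ⟨hs₂, hp₂, htr₂⟩ := hscale _ hTm
  obtain ⟨σ₁, hσ₁, hmem₁⟩ := mk_mem_subsolutions μp w₁ q hs₁ hp₁ htr₁
  obtain ⟨σ₂, hσ₂, hmem₂⟩ := mk_mem_subsolutions μm w₂ q hs₂ hp₂ htr₂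
  refine mem_convexJoin.2 ⟨_, hmem₁, _, hmem₂, t, 1 - t, ht0.le, ht1'.le, by ring, ?_⟩
  refine Prod.ext rfl (Prod.ext rfl (Prod.ext rfl (Prod.ext (Subtype.ext ?_) ?_)))
  · have hcoef : t * ((n * e - μp * ‖w₁‖ ^ 2) / P.trace) +
        (1 - t) * ((n * e - μm * ‖w₂‖ ^ 2) / P.trace) = 1 := by
      rw [← mul_div_assoc, ← mul_div_assoc, ← add_div, ← hPtr, div_self hPpos.ne']
    simp only [Prod.snd_add, Prod.fst_add, Prod.smul_snd, Prod.smul_fst, Submodule.coe_add,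
      Submodule.coe_smul, hσ₁, hσ₂]
    linear_combination (norm := module) hcoef • P + hP
  · simp only [Prod.snd_add, Prod.smul_snd, smul_eq_mul]
    ring

end ConvexHull

/-- The convex hull of `K` equals the closure of `U`. -/
theorem convexHull_K_eq_closure_U (n : ℕ) (hn : 2 ≤ n) (μm μp : ℝ) (hμm : 0 < μm)
    (hμ : μm < μp) (e : ℝ) (he : 0 < e) :
    convexHull ℝ (Kset n μm μp e) = closure (Uset n μm μp e) := by
  have hn' : 0 < n := by omega
  have hμp := hμm.trans hμ
  rw [convexHull_Kset_eq_convexJoin hμm hμp he.le]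
  exact (convexJoin_subsolutions_subset_closure_Uset hn' hμm hμ he).antisymm
    (closure_minimal (Uset_subset_convexJoin_subsolutions hn' hμ)
      (isClosed_convexJoin_subsolutions hμm hμp he.le))
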